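/- arXiv:1802.04366 — 2 statements merged into one kernel-verified Lean document; each statement's English description precedes it below -/
import Mathlib

section
/- Let g ∈ ℝ^d with g ≠ 0, let ĝ = g/‖g‖, and for v ∈ ℝ^d define the parallel projection P_∥ v = ⟨v, ĝ⟩ ĝ and the orthogonal projection P_⊥ v = v - P_∥ v. Let ψ_d be the standard Gaussian density on ℝ^d. Then for every bounded measurable f : ℝ^d → ℝ, ∫_{ℝ^d} ∫_{ℝ^d} max{0, ⟨v, g⟩} f(-P_∥ v + P_⊥ ξ) ψ_d(v) ψ_d(ξ) dv dξ = ∫_{ℝ^d} max{0, -⟨v, g⟩} f(v) ψ_d(v) dv. -/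
open scoped InnerProductSpace
open MeasureTheory

/-- The standard Gaussian density on `ℝ^d`. -/
noncomputable def gaussDensity (d : ℕ) (v : EuclideanSpace ℝ (Fin d)) : ℝ :=
  (2 * Real.pi) ^ (-(d : ℝ) / 2) * Real.exp (-‖v‖ ^ 2 / 2)

open ProbabilityTheory Complex in
/-- If `u` is a unit vector, replacing the component orthogonal to `u` of a standard Gaussian by
that of an independent copy and flipping the component along `u` gives a standard Gaussian. -/
theorem map_bounce_stdGaussian {E : Type*} [NormedAddCommGroup E] [InnerProductSpace ℝ E]
    [FiniteDimensional ℝ E] [MeasurableSpace E] [BorelSpace E] {u : E} (hu : ‖u‖ = 1) :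
    ((stdGaussian E).prod (stdGaussian E)).map
      (fun p ↦ -(⟪p.2, u⟫_ℝ • u) + (p.1 - ⟪p.1, u⟫_ℝ • u)) = stdGaussian E := by
  have hmeas : Measurable fun p : E × E ↦ -(⟪p.2, u⟫_ℝ • u) + (p.1 - ⟪p.1, u⟫_ℝ • u) := by
    fun_prop
  have := Measure.isProbabilityMeasure_map (μ := (stdGaussian E).prod (stdGaussian E))
    hmeas.aemeasurable
  apply Measure.ext_of_charFun
  ext t
  have hsplit (p : E × E) :
      cexp (⟪-(⟪p.2, u⟫_ℝ • u) + (p.1 - ⟪p.1, u⟫_ℝ • u), t⟫_ℝ * I) =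
        cexp (⟪p.1, t - ⟪u, t⟫_ℝ • u⟫_ℝ * I) * cexp (⟪p.2, -(⟪u, t⟫_ℝ • u)⟫_ℝ * I) := by
    rw [← Complex.exp_add, ← add_mul, ← ofReal_add]
    congr 3
    simp only [inner_add_left, inner_neg_left, inner_sub_left, real_inner_smul_left,
      inner_neg_right, inner_sub_right, real_inner_smul_right]
    ring
  have hnorm : ‖t - ⟪u, t⟫_ℝ • u‖ ^ 2 + ‖-(⟪u, t⟫_ℝ • u)‖ ^ 2 = ‖t‖ ^ 2 := by
    rw [norm_neg, norm_sub_sq_real, norm_smul, hu, real_inner_smul_right, real_inner_comm u t,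
      Real.norm_eq_abs, mul_one, sq_abs]
    ring
  rw [charFun_apply, integral_map hmeas.aemeasurable (by fun_prop)]
  simp_rw [hsplit]
  rw [integral_prod_mul (fun x ↦ cexp (⟪x, t - ⟪u, t⟫_ℝ • u⟫_ℝ * I))
      (fun x ↦ cexp (⟪x, -(⟪u, t⟫_ℝ • u)⟫_ℝ * I)),
    ← charFun_apply, ← charFun_apply, charFun_stdGaussian, charFun_stdGaussian,
    charFun_stdGaussian, ← Complex.exp_add]
  congr 1
  rw [← add_div, ← neg_add]
  norm_cast
  rw [hnorm]

theorem gaussDensity_nonneg (d : ℕ) (v : EuclideanSpace ℝ (Fin d)) : 0 ≤ gaussDensity d v := by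
  unfold gaussDensity
  positivity

@[fun_prop]
theorem continuous_gaussDensity (d : ℕ) : Continuous (gaussDensity d) := by
  unfold gaussDensity
  fun_prop

theorem integral_withDensity_gaussDensity {F : Type*} [NormedAddCommGroup F] [NormedSpace ℝ F]
    (d : ℕ) (h : EuclideanSpace ℝ (Fin d) → F) :
    ∫ v, h v ∂(volume.withDensity fun v ↦ ENNReal.ofReal (gaussDensity d v)) =
      ∫ v, gaussDensity d v • h v := by
  rw [integral_withDensity_eq_integral_toReal_smul₀ (by fun_prop) (by simp)]
  simp_rw [ENNReal.toReal_ofReal (gaussDensity_nonneg d _)]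

theorem integrable_gaussDensity (d : ℕ) : Integrable (gaussDensity d) := by
  have h := GaussianFourier.integral_rexp_neg_mul_sq_norm (V := EuclideanSpace ℝ (Fin d))
    (b := 1 / 2) (by norm_num)
  have hint : Integrable fun v : EuclideanSpace ℝ (Fin d) ↦ Real.exp (-(1 / 2) * ‖v‖ ^ 2) := by
    refine Integrable.of_integral_ne_zero ?_
    rw [h]
    positivity
  refine (hint.const_mul ((2 * Real.pi) ^ (-(d : ℝ) / 2))).congr (.of_forall fun v ↦ ?_)
  simp only [gaussDensity]
  congr 2
  ring

open ProbabilityTheory Complex in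
theorem withDensity_gaussDensity (d : ℕ) :
    volume.withDensity (fun v ↦ ENNReal.ofReal (gaussDensity d v)) =
      stdGaussian (EuclideanSpace ℝ (Fin d)) := by
  have := isFiniteMeasure_withDensity_ofReal (integrable_gaussDensity d).2
  apply Measure.ext_of_charFun
  ext t
  have hconst : (((2 * Real.pi) ^ (-(d : ℝ) / 2) : ℝ) : ℂ) *
      (Real.pi / (1 / 2 : ℂ)) ^ ((d : ℂ) / 2) = 1 := by
    have : (Real.pi / (1 / 2 : ℂ)) ^ ((d : ℂ) / 2) =
        (((2 * Real.pi) ^ ((d : ℝ) / 2) : ℝ) : ℂ) := by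
      rw [ofReal_cpow (by positivity)]
      push_cast
      congr 1
      ring
    rw [this, ← ofReal_mul, ← Real.rpow_add (by positivity), neg_div, neg_add_cancel,
      Real.rpow_zero, ofReal_one]
  rw [charFun_apply, integral_withDensity_gaussDensity, charFun_stdGaussian]
  have hexp (v : EuclideanSpace ℝ (Fin d)) : gaussDensity d v • cexp (⟪v, t⟫_ℝ * I) =
      (((2 * Real.pi) ^ (-(d : ℝ) / 2) : ℝ) : ℂ) *
        cexp (-(1 / 2 : ℂ) * ‖v‖ ^ 2 + I * ⟪t, v⟫_ℝ) := by
    rw [gaussDensity, real_smul, ofReal_mul, ofReal_exp, mul_assoc, ← Complex.exp_add,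
      real_inner_comm]
    congr 2
    push_cast
    ring
  simp_rw [hexp]
  rw [integral_const_mul, GaussianFourier.integral_cexp_neg_mul_sq_norm_add (by norm_num),
    finrank_euclideanSpace_fin, ← mul_assoc, hconst, one_mul, I_sq]
  congr 1
  ring

open ProbabilityTheory in
theorem integral_stdGaussian_eq_integral_gaussDensity {d : ℕ}
    (h : EuclideanSpace ℝ (Fin d) → ℝ) :
    ∫ v, h v ∂(stdGaussian (EuclideanSpace ℝ (Fin d))) = ∫ v, h v * gaussDensity d v := by
  simp_rw [← withDensity_gaussDensity, integral_withDensity_gaussDensity, smul_eq_mul, mul_comm]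

open ProbabilityTheory in
/-- Key identity for the stochastic bounce kernel of the Stochastic Bouncy
Hybrid Sampler: flipping the component of `v` parallel to `g` and resampling
the orthogonal component from the standard Gaussian. -/
theorem stmt_6 {d : ℕ} (g : EuclideanSpace ℝ (Fin d)) (hg : g ≠ 0)
    (ghat : EuclideanSpace ℝ (Fin d)) (hghat : ghat = ‖g‖⁻¹ • g)
    (Ppar Pperp : EuclideanSpace ℝ (Fin d) → EuclideanSpace ℝ (Fin d))
    (hPpar : ∀ v, Ppar v = ⟪v, ghat⟫_ℝ • ghat)
    (hPperp : ∀ v, Pperp v = v - Ppar v)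
    (f : EuclideanSpace ℝ (Fin d) → ℝ) (hf : Measurable f)
    (hfb : ∃ C, ∀ v, |f v| ≤ C) :
    ∫ ξ, ∫ v, max 0 ⟪v, g⟫_ℝ * f (-Ppar v + Pperp ξ) * gaussDensity d v
        * gaussDensity d ξ
      = ∫ v, max 0 (-⟪v, g⟫_ℝ) * f v * gaussDensity d v := by
  obtain ⟨C, hC⟩ := hfb
  have hu : ‖ghat‖ = 1 := by
    rw [hghat, norm_smul, norm_inv, norm_norm, inv_mul_cancel₀ (norm_ne_zero_iff.2 hg)]
  have hg_eq : g = ‖g‖ • ghat := by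
    rw [hghat, smul_inv_smul₀ (norm_ne_zero_iff.2 hg)]
  set γ := stdGaussian (EuclideanSpace ℝ (Fin d)) with hγ
  set F : EuclideanSpace ℝ (Fin d) → ℝ := fun w ↦ max 0 (-⟪w, g⟫_ℝ) * f w with hF
  have hFint : Integrable F γ := by
    have hinner : Integrable (fun w ↦ ⟪w, g⟫_ℝ) γ :=
      (IsGaussian.integrable_id (μ := γ)).inner_const g
    refine ((integrable_zero _ _ _).sup hinner.neg).mul_bdd (c := C)
      hf.aestronglyMeasurable ?_
    exact .of_forall hC
  have hmap := map_bounce_stdGaussian hu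
  rw [← hγ] at hmap
  have hmeas : Measurable fun p : EuclideanSpace ℝ (Fin d) × EuclideanSpace ℝ (Fin d) ↦
      -(⟪p.2, ghat⟫_ℝ • ghat) + (p.1 - ⟪p.1, ghat⟫_ℝ • ghat) := by fun_prop
  have hbounce (ξ v : EuclideanSpace ℝ (Fin d)) :
      max 0 ⟪v, g⟫_ℝ * f (-Ppar v + Pperp ξ) =
        F (-(⟪v, ghat⟫_ℝ • ghat) + (ξ - ⟪ξ, ghat⟫_ℝ • ghat)) := by
    have : -⟪-(⟪v, ghat⟫_ℝ • ghat) + (ξ - ⟪ξ, ghat⟫_ℝ • ghat), g⟫_ℝ = ⟪v, g⟫_ℝ := by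
      rw [hg_eq]
      simp only [inner_add_left, inner_neg_left, inner_sub_left, real_inner_smul_left,
        real_inner_smul_right, real_inner_self_eq_norm_sq, hu]
      ring
    simp only [hF, hPperp, hPpar, this]
  calc
    _ = ∫ ξ, ∫ v, F (-(⟪v, ghat⟫_ℝ • ghat) + (ξ - ⟪ξ, ghat⟫_ℝ • ghat)) ∂γ ∂γ := by
      simp_rw [hγ, integral_stdGaussian_eq_integral_gaussDensity, hbounce, integral_mul_const]
    _ = ∫ w, F w ∂γ := by
      rw [← hmap] at hFint
      conv_rhs => rw [← hmap, integral_map hmeas.aemeasurable hFint.aestronglyMeasurable]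
      exact (integral_prod _ (hFint.comp_measurable hmeas)).symm
    _ = _ := by rw [hγ, integral_stdGaussian_eq_integral_gaussDensity]
end

section
/- (Invariant density of the Coordinate Bouncy Hybrid Sampler, coordinatewise identity.) Let U : ℝ^d → ℝ be continuously differentiable with ∫ e^{-U(x)} dx < ∞, let g = (g_1, …, g_d) : ℝ^d → ℝ^d be continuous, fix i ∈ {1, …, d}, let R_i : ℝ^d → ℝ^d flip the sign of the i-th coordinate and leave the others unchanged, and let γ_i : ℝ^d × ℝ^d → [0, ∞) be bounded measurable with γ_i(x, R_i v) = γ_i(x, v) for all (x,v). Set λ_i(x,v) = max{0, v_i g_i(x)} + γ_i(x,v). Then for every smooth compactly supported f : ℝ^d × ℝ^d → ℝ, ∫∫ [ ∂_{x_i} f(x,v) · v_i + ∂_{v_i} f(x,v) · (-∂_{x_i} U(x) + g_i(x)) + λ_i(x,v) (f(x, R_i v) - f(x,v)) ] e^{-U(x)} ψ_d(v) dx dv = 0. -/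
open scoped InnerProductSpace
open MeasureTheory

/-- Integration by parts in the direction `v` against a compactly supported `C¹` function; the
other factor only needs a continuous line derivative. -/
theorem integral_fderiv_mul_eq_neg_of_hasLineDerivAt {E : Type*} [NormedAddCommGroup E]
    [NormedSpace ℝ E] [FiniteDimensional ℝ E] [MeasurableSpace E] [BorelSpace E]
    {μ : Measure E} [μ.IsAddHaarMeasure] {f h h' : E → ℝ} {v : E}
    (hf : ContDiff ℝ 1 f) (hfc : HasCompactSupport f) (hh : Continuous h) (hh' : Continuous h')
    (hderiv : ∀ x, HasLineDerivAt ℝ h (h' x) x v) :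
    ∫ x, fderiv ℝ f x v * h x ∂μ = -∫ x, f x * h' x ∂μ := by
  have hf' : Continuous fun x => fderiv ℝ f x v :=
    (hf.continuous_fderiv one_ne_zero).clm_apply continuous_const
  have key := integral_bilinear_hasLineDerivAt_right_eq_neg_left_of_integrable
    (μ := μ) (f := f) (f' := fun x => fderiv ℝ f x v) (g := h) (g' := h') (v := v)
    (B := ContinuousLinearMap.mul ℝ ℝ)
    ((hf'.mul hh).integrable_of_hasCompactSupport (hfc.fderiv_apply ℝ v).mul_right)
    ((hf.continuous.mul hh').integrable_of_hasCompactSupport hfc.mul_right)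
    ((hf.continuous.mul hh).integrable_of_hasCompactSupport hfc.mul_right)
    (fun x _ => (hf.differentiable one_ne_zero x).hasFDerivAt.hasLineDerivAt v)
    (fun x _ => hderiv x)
  simp only [ContinuousLinearMap.mul_apply'] at key
  rw [key, neg_neg]

theorem contDiff_gaussDensity (d : ℕ) : ContDiff ℝ 1 (gaussDensity d) := by
  unfold gaussDensity
  exact contDiff_const.mul (((contDiff_norm_sq ℝ).neg.div_const 2).exp)

theorem hasLineDerivAt_gaussDensity {d : ℕ} (v : EuclideanSpace ℝ (Fin d)) (i : Fin d) :
    HasLineDerivAt ℝ (gaussDensity d) (-v i * gaussDensity d v) v (EuclideanSpace.single i 1) := by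
  have h := ((((hasStrictFDerivAt_norm_sq v).hasFDerivAt.hasLineDerivAt
    (EuclideanSpace.single i 1)).neg.div_const 2).exp.const_mul
      ((2 * Real.pi) ^ (-(d : ℝ) / 2)))
  unfold HasLineDerivAt gaussDensity
  convert! h using 1
  simp [EuclideanSpace.inner_single_right]
  ring

/-- The linear isometry of `ℝ^d` flipping the sign of the `i`-th coordinate. -/
theorem exists_linearIsometryEquiv_eq_coordFlip {d : ℕ} {i : Fin d}
    {R : EuclideanSpace ℝ (Fin d) → EuclideanSpace ℝ (Fin d)}
    (hR : ∀ v j, R v j = if j = i then -(v j) else v j) :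
    ∃ L : EuclideanSpace ℝ (Fin d) ≃ₗᵢ[ℝ] EuclideanSpace ℝ (Fin d), ⇑L = R := by
  refine ⟨⟨LinearEquiv.ofInvolutive ⟨⟨R, fun v w => ?_⟩, fun c v => ?_⟩ fun v => ?_, fun v => ?_⟩,
    rfl⟩
  · ext j
    by_cases h : j = i <;> simp [hR, h, add_comm]
  · ext j
    by_cases h : j = i <;> simp [hR, h]
  · ext j
    by_cases h : j = i <;> simp [hR, h]
  · simp only [EuclideanSpace.norm_eq]
    congr 1
    refine Finset.sum_congr rfl fun j _ => ?_
    change ‖R v j‖ ^ 2 = _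
    by_cases h : j = i <;> simp [hR, h]

/-- Invariant density of the Coordinate Bouncy Hybrid Sampler, coordinatewise
identity: the integral of the `i`-th term `𝒜_i f` of the infinitesimal
generator against `ρ(x,v) ∝ e^{-U(x)} ψ_d(v)` vanishes. -/
theorem stmt_10 {d : ℕ} (U : EuclideanSpace ℝ (Fin d) → ℝ) (hU : ContDiff ℝ 1 U)
    (hUint : Integrable (fun x => Real.exp (-U x)))
    (g : EuclideanSpace ℝ (Fin d) → EuclideanSpace ℝ (Fin d)) (hg : Continuous g)
    (i : Fin d)
    (Ri : EuclideanSpace ℝ (Fin d) → EuclideanSpace ℝ (Fin d))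
    (hRi : ∀ v j, Ri v j = if j = i then -(v j) else v j)
    (gamma : EuclideanSpace ℝ (Fin d) × EuclideanSpace ℝ (Fin d) → ℝ)
    (hgam_meas : Measurable gamma) (hgam_nonneg : ∀ z, 0 ≤ gamma z)
    (hgam_bdd : ∃ C, ∀ z, gamma z ≤ C)
    (hgam_sym : ∀ x v, gamma (x, Ri v) = gamma (x, v))
    (lam : EuclideanSpace ℝ (Fin d) → EuclideanSpace ℝ (Fin d) → ℝ)
    (hlam : ∀ x v, lam x v = max 0 (v i * g x i) + gamma (x, v))
    (f : EuclideanSpace ℝ (Fin d) × EuclideanSpace ℝ (Fin d) → ℝ)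
    (hf : ContDiff ℝ (⊤ : ℕ∞) f) (hfc : HasCompactSupport f) :
    ∫ x, ∫ v,
        (fderiv ℝ (fun y => f (y, v)) x (EuclideanSpace.single i 1) * v i
          + fderiv ℝ (fun w => f (x, w)) v (EuclideanSpace.single i 1)
            * (-(fderiv ℝ U x (EuclideanSpace.single i 1)) + g x i)
          + lam x v * (f (x, Ri v) - f (x, v)))
        * (Real.exp (-U x) * gaussDensity d v) = 0 := by
  obtain ⟨L, rfl⟩ := exists_linearIsometryEquiv_eq_coordFlip hRi
  obtain ⟨C, hC⟩ := hgam_bdd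
  have hf1 : ContDiff ℝ 1 f := hf.of_le (by exact_mod_cast le_top)
  set e : EuclideanSpace ℝ (Fin d) := EuclideanSpace.single i 1 with he
  have hfd (z) : HasFDerivAt f (fderiv ℝ f z) z :=
    (hf1.differentiable one_ne_zero z).hasFDerivAt
  have hfx (x v) : fderiv ℝ (fun y => f (y, v)) x e = fderiv ℝ f (x, v) (e, 0) := by
    have h := HasFDerivAt.comp (f := fun y => (y, v)) x (hfd (x, v)) (hasFDerivAt_prodMk_left x v)
    rw [show (fun y => f (y, v)) = f ∘ fun y => (y, v) from rfl, h.fderiv]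
    simp
  have hfv (x v) : fderiv ℝ (fun w => f (x, w)) v e = fderiv ℝ f (x, v) (0, e) := by
    have h := HasFDerivAt.comp (f := fun w => (x, w)) v (hfd (x, v)) (hasFDerivAt_prodMk_right x v)
    rw [show (fun w => f (x, w)) = f ∘ fun w => (x, w) from rfl, h.fderiv]
    simp
  have hdU : Continuous fun x => fderiv ℝ U x e :=
    (hU.continuous_fderiv one_ne_zero).clm_apply continuous_const
  have hUc : Continuous U := hU.continuous
  have hψ : Continuous (gaussDensity d) := (contDiff_gaussDensity d).continuous
  let ρ : EuclideanSpace ℝ (Fin d) × EuclideanSpace ℝ (Fin d) → ℝ :=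
    fun z => Real.exp (-U z.1) * gaussDensity d z.2
  have hρ : Continuous ρ := by fun_prop
  let S : EuclideanSpace ℝ (Fin d) × EuclideanSpace ℝ (Fin d) ≃ₜ
      EuclideanSpace ℝ (Fin d) × EuclideanSpace ℝ (Fin d) :=
    (Homeomorph.refl _).prodCongr L.toHomeomorph
  have hS : MeasurePreserving S :=
    (MeasurePreserving.id volume).prod L.measurePreserving
  have hρS (z) : ρ (S z) = ρ z := by
    simp [ρ, S, gaussDensity]
  have hSS (z) : S (S z) = z := by
    refine Prod.ext rfl ?_
    ext j
    change L (L z.2) j = z.2 j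
    by_cases h : j = i <;> simp [hRi, h]
  have hlam_int {φ : EuclideanSpace ℝ (Fin d) × EuclideanSpace ℝ (Fin d) → ℝ}
      (hφ : Continuous φ) (hφc : HasCompactSupport φ) :
      Integrable fun z => lam z.1 z.2 * φ z := by
    have h1 : Integrable fun z => max 0 (z.2 i * g z.1 i) * φ z :=
      Continuous.integrable_of_hasCompactSupport (by fun_prop) hφc.mul_left
    have h2 : Integrable fun z => gamma z * φ z :=
      (hφ.integrable_of_hasCompactSupport hφc).bdd_mul (c := C)
        hgam_meas.aestronglyMeasurable
        (.of_forall fun z => by rw [Real.norm_of_nonneg (hgam_nonneg z)]; exact hC z)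
    refine (h1.add h2).congr (.of_forall fun z => ?_)
    simp only [Pi.add_apply, hlam]
    ring
  have hfS : Continuous (f ∘ S) := hf1.continuous.comp S.continuous
  have hfSc : HasCompactSupport (f ∘ S) := hfc.comp_homeomorph S
  have hd1 (w) : Continuous fun z => fderiv ℝ f z w :=
    (hf1.continuous_fderiv one_ne_zero).clm_apply continuous_const
  have hi1 : Integrable fun z => fderiv ℝ f z (e, 0) * (z.2 i * ρ z) :=
    Continuous.integrable_of_hasCompactSupport ((hd1 _).mul (by fun_prop))
      (hfc.fderiv_apply ℝ _).mul_right
  have hi2 : Integrable fun z =>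
      fderiv ℝ f z (0, e) * ((-(fderiv ℝ U z.1 e) + g z.1 i) * ρ z) :=
    Continuous.integrable_of_hasCompactSupport
      ((hd1 _).mul (((hdU.comp continuous_fst).neg.add (by fun_prop)).mul hρ))
      (hfc.fderiv_apply ℝ _).mul_right
  have hi3 : Integrable fun z => lam z.1 z.2 * (f (S z) * ρ z) :=
    hlam_int (hfS.mul hρ) hfSc.mul_right
  have hi4 : Integrable fun z => lam z.1 z.2 * (f z * ρ z) :=
    hlam_int (hf1.continuous.mul hρ) hfc.mul_right
  have : Measure.IsAddHaarMeasure
      (volume : Measure (EuclideanSpace ℝ (Fin d) × EuclideanSpace ℝ (Fin d))) :=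
    Measure.prod.instIsAddHaarMeasure volume volume
  have ibp_x : ∫ z, fderiv ℝ f z (e, 0) * (z.2 i * ρ z)
      = -∫ z, f z * (z.2 i * (-(fderiv ℝ U z.1 e) * ρ z)) := by
    refine integral_fderiv_mul_eq_neg_of_hasLineDerivAt hf1 hfc (by fun_prop) ?_ fun z => ?_
    · exact Continuous.mul (by fun_prop) ((hdU.comp continuous_fst).neg.mul hρ)
    · have h := ((hU.differentiable one_ne_zero z.1).hasFDerivAt.hasLineDerivAt e).neg.exp
        |>.mul_const (gaussDensity d z.2) |>.const_mul (z.2 i)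
      unfold HasLineDerivAt
      convert! h using 1
      · ext t
        simp [ρ]
      · simp only [ρ, Pi.neg_apply, zero_smul, add_zero]
        ring
  have ibp_v : ∫ z, fderiv ℝ f z (0, e) * ((-(fderiv ℝ U z.1 e) + g z.1 i) * ρ z)
      = -∫ z, f z * ((-(fderiv ℝ U z.1 e) + g z.1 i) * (-z.2 i * ρ z)) := by
    refine integral_fderiv_mul_eq_neg_of_hasLineDerivAt hf1 hfc ?_ ?_ fun z => ?_
    · exact ((hdU.comp continuous_fst).neg.add (by fun_prop)).mul hρ
    · exact ((hdU.comp continuous_fst).neg.add (by fun_prop)).mul (by fun_prop)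
    · have h := (((hasLineDerivAt_gaussDensity z.2 i).const_mul (Real.exp (-U z.1))).const_mul
        (-(fderiv ℝ U z.1 e) + g z.1 i))
      unfold HasLineDerivAt
      convert! h using 1
      · ext t
        simp [ρ, he]
      · simp only [ρ]
        ring
  have flip : ∫ z, lam z.1 z.2 * (f (S z) * ρ z) = ∫ z, lam z.1 (L z.2) * (f z * ρ z) := by
    rw [← hS.integral_comp S.measurableEmbedding]
    refine integral_congr_ae (.of_forall fun z => ?_)
    simp only [hρS, hSS]
    rfl
  have hi3' : Integrable fun z => lam z.1 (L z.2) * (f z * ρ z) := by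
    refine ((hS.integrable_comp_emb S.measurableEmbedding).2 hi3).congr (.of_forall fun z => ?_)
    simp only [Function.comp_apply, hρS, hSS]
    rfl
  have hj1 : Integrable fun z => f z * (z.2 i * (-(fderiv ℝ U z.1 e) * ρ z)) :=
    Continuous.integrable_of_hasCompactSupport (hf1.continuous.mul
      (Continuous.mul (by fun_prop) ((hdU.comp continuous_fst).neg.mul hρ))) hfc.mul_right
  have hj2 : Integrable fun z =>
      f z * ((-(fderiv ℝ U z.1 e) + g z.1 i) * (-z.2 i * ρ z)) :=
    Continuous.integrable_of_hasCompactSupport (hf1.continuous.mul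
      (((hdU.comp continuous_fst).neg.add (by fun_prop)).mul (by fun_prop))) hfc.mul_right
  simp only [hfx, hfv]
  have hsplit : ∀ z : EuclideanSpace ℝ (Fin d) × EuclideanSpace ℝ (Fin d),
      (fderiv ℝ f (z.1, z.2) (e, 0) * z.2 i
        + fderiv ℝ f (z.1, z.2) (0, e) * (-(fderiv ℝ U z.1 e) + g z.1 i)
        + lam z.1 z.2 * (f (z.1, L z.2) - f (z.1, z.2)))
        * (Real.exp (-U z.1) * gaussDensity d z.2)
      = fderiv ℝ f z (e, 0) * (z.2 i * ρ z)
        + fderiv ℝ f z (0, e) * ((-(fderiv ℝ U z.1 e) + g z.1 i) * ρ z)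
        + (lam z.1 z.2 * (f (S z) * ρ z) - lam z.1 z.2 * (f z * ρ z)) := by
    intro z
    simp only [ρ, Prod.mk.eta, show S z = (z.1, L z.2) from rfl]
    ring
  rw [integral_integral (f := fun x v => (fderiv ℝ f (x, v) (e, 0) * v i
        + fderiv ℝ f (x, v) (0, e) * (-(fderiv ℝ U x e) + g x i)
        + lam x v * (f (x, L v) - f (x, v))) * (Real.exp (-U x) * gaussDensity d v))
    (((hi1.add hi2).add (hi3.sub hi4)).congr (.of_forall fun z => (hsplit z).symm))]
  simp only [hsplit]
  refine (integral_add (hi1.add hi2) (hi3.sub hi4)).trans ?_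
  simp only [Pi.add_apply, Pi.sub_apply]
  rw [integral_add hi1 hi2, integral_sub hi3 hi4, ibp_x, ibp_v, flip, ← neg_add,
    ← integral_add hj1 hj2, ← integral_sub hi3' hi4, neg_add_eq_zero]
  refine integral_congr_ae (.of_forall fun z => ?_)
  have hmax : max 0 (-(z.2 i * g z.1 i)) - max 0 (z.2 i * g z.1 i) = -(z.2 i * g z.1 i) := by
    rw [max_comm 0, max_comm 0]
    linarith [max_zero_sub_eq_self (z.2 i * g z.1 i)]
  simp only [hlam, hgam_sym, hRi, if_true, neg_mul]
  linear_combination (-(f z * ρ z)) * hmax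
end
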